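/- Suppose the product ζ·η is disjoint: ζ and η have disjoint supports and |ζη| = |ζ| + |η|, where |ξ| := ℓ(ξu) − ℓ(u) for any u ∈ S_∞ and k ∈ ℕ with u ≤_k ξu. Then the map (α,β) ↦ αβ induces an order isomorphism from the product of intervals [e,ζ]_⪯ × [e,η]_⪯ onto the interval [e,ζη]_⪯. -/

import Mathlib

/-- A permutation of the positive integers belongs to `S_∞` when it moves only
finitely many points. -/
def FinSupp (w : Equiv.Perm ℕ+) : Prop := {x : ℕ+ | w x ≠ x}.Finite

/-- The length `ℓ(w)` of a permutation: its number of inversions, i.e. of pairs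
`i < j` with `w i > w j`. -/
noncomputable def len (w : Equiv.Perm ℕ+) : ℕ :=
  Set.ncard {p : ℕ+ × ℕ+ | p.1 < p.2 ∧ w p.2 < w p.1}

/-- Covering relation of the `k`-Bruhat order: `u ⋖_k u(a,b)` for `a ≤ k < b`
with `ℓ(u(a,b)) = ℓ(u) + 1`.  Here `u(a,b) = u * (swap a b)`. -/
def kBruhatCov (k : ℕ+) (u w : Equiv.Perm ℕ+) : Prop :=
  ∃ a b : ℕ+, a ≤ k ∧ k < b ∧ w = u * Equiv.swap a b ∧ len w = len u + 1

/-- The `k`-Bruhat order `u ≤_k w`: a chain of `k`-Bruhat covers from `u` to `w`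
(or `u = w`). -/
def kBruhat (k : ℕ+) : Equiv.Perm ℕ+ → Equiv.Perm ℕ+ → Prop :=
  Relation.ReflTransGen (kBruhatCov k)
/-- The new partial order `⪯` on `S_∞`: `η ⪯ ζ` iff there exist `u ∈ S_∞` and
`k` with `u ≤_k ηu ≤_k ζu`. -/
def NewOrder (η ζ : Equiv.Perm ℕ+) : Prop :=
  ∃ (u : Equiv.Perm ℕ+) (k : ℕ+), FinSupp u ∧
    kBruhat k u (η * u) ∧ kBruhat k (η * u) (ζ * u)

/-- Indicator that the arcs `x → x'` and `y → y'` reverse the order of `x` and `y`. -/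
def invInd (x x' y y' : ℕ+) : ℤ :=
  if (x < y ∧ y' < x') ∨ (y < x ∧ x' < y') then 1 else 0

/-- Direction of the arc `x → x'`. -/
def arcSign (x x' : ℕ+) : ℤ := if x < x' then 1 else if x' < x then -1 else 0

/-- Indicator that `y` lies strictly under the arc `x → x'`. -/
def overInd (x x' y : ℕ+) : ℤ := if (x < y ∧ y < x') ∨ (x' < y ∧ y < x) then 1 else 0

/-- The arcs `x → x'` and `y → y'` have the same direction and cross. -/
def SameCross (x x' y y' : ℕ+) : Prop :=
  (x < y ∧ y < x' ∧ x' < y') ∨ (y < x ∧ x < y' ∧ y' < x') ∨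
    (x' < y' ∧ y' < x ∧ x < y) ∨ (y' < x' ∧ x' < y ∧ y < x)

/-- `w` fixes every number above `N`. -/
def FixAbove (N : ℕ+) (w : Equiv.Perm ℕ+) : Prop := ∀ x, N < x → w x = x

theorem FinSupp.exists_fixAbove {w : Equiv.Perm ℕ+} (h : FinSupp w) : ∃ N, FixAbove N w := by
  obtain ⟨N, hN⟩ := h.bddAbove
  refine ⟨N, fun x hx => ?_⟩
  by_contra hne
  exact absurd (hN hne) (not_le.mpr hx)

theorem FixAbove.mono {N M : ℕ+} {w : Equiv.Perm ℕ+} (h : FixAbove N w) (hNM : N ≤ M) :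
    FixAbove M w := fun x hx => h x (hNM.trans_lt hx)

theorem FixAbove.finSupp {N : ℕ+} {w : Equiv.Perm ℕ+} (h : FixAbove N w) : FinSupp w := by
  refine (Set.finite_Icc 1 N).subset fun x hx => ⟨one_le, ?_⟩
  by_contra hlt
  exact hx (h x (not_le.mp hlt))

theorem FixAbove.mul {N : ℕ+} {v w : Equiv.Perm ℕ+} (hv : FixAbove N v) (hw : FixAbove N w) :
    FixAbove N (v * w) := fun x hx => by
  rw [Equiv.Perm.mul_apply, hw x hx, hv x hx]

theorem FixAbove.mem_iff {N : ℕ+} {w : Equiv.Perm ℕ+} (h : FixAbove N w) (x : ℕ+) :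
    x ∈ Finset.Icc 1 N ↔ w x ∈ Finset.Icc 1 N := by
  simp only [Finset.mem_Icc, one_le, true_and]
  constructor
  · intro hx
    by_contra hlt
    have := w.injective (h (w x) (not_le.mp hlt))
    rw [this] at hlt
    exact hlt hx
  · intro hx
    by_contra hlt
    rw [h x (not_le.mp hlt)] at hx
    exact hlt hx

theorem FixAbove.sum_comp {N : ℕ+} {w : Equiv.Perm ℕ+} (h : FixAbove N w) (f : ℕ+ → ℤ) :
    ∑ x ∈ Finset.Icc 1 N, f (w x) = ∑ x ∈ Finset.Icc 1 N, f x :=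
  Finset.sum_equiv w (fun x => h.mem_iff x) (fun _ _ => rfl)

theorem FinSupp.mul {v w : Equiv.Perm ℕ+} (hv : FinSupp v) (hw : FinSupp w) :
    FinSupp (v * w) := by
  obtain ⟨N, hN⟩ := hv.exists_fixAbove
  obtain ⟨M, hM⟩ := hw.exists_fixAbove
  exact ((hN.mono (le_max_left N M)).mul (hM.mono (le_max_right N M))).finSupp

theorem FinSupp.inv {w : Equiv.Perm ℕ+} (hw : FinSupp w) : FinSupp w⁻¹ := by
  obtain ⟨N, hN⟩ := hw.exists_fixAbove
  refine FixAbove.finSupp (N := N) fun x hx => ?_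
  rw [Equiv.Perm.inv_eq_iff_eq, hN x hx]

theorem finSupp_swap (a b : ℕ+) : FinSupp (Equiv.swap a b) := by
  refine (Set.toFinite {a, b}).subset fun x hx => ?_
  by_contra h
  simp only [Set.mem_insert_iff, Set.mem_singleton_iff, not_or] at h
  exact hx (Equiv.swap_apply_of_ne_of_ne h.1 h.2)

theorem sum_invInd_eq_two_mul_len {N : ℕ+} {w : Equiv.Perm ℕ+} (h : FixAbove N w) :
    ∑ i ∈ Finset.Icc 1 N, ∑ j ∈ Finset.Icc 1 N, invInd i (w i) j (w j) = 2 * (len w : ℤ) := by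
  have hset : {p : ℕ+ × ℕ+ | p.1 < p.2 ∧ w p.2 < w p.1} =
      ((Finset.Icc 1 N ×ˢ Finset.Icc 1 N).filter
        (fun p : ℕ+ × ℕ+ => p.1 < p.2 ∧ w p.2 < w p.1) : Finset (ℕ+ × ℕ+)) := by
    ext ⟨i, j⟩
    simp only [Set.mem_ofPred_eq, Finset.coe_filter, Finset.mem_product, Finset.mem_Icc,
      one_le, true_and]
    refine ⟨fun hij => ⟨?_, hij⟩, fun hij => hij.2⟩
    have hj : j ≤ N := by
      by_contra hlt
      have hj := h j (not_le.mp hlt)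
      have hi : N < w i := by have := hij.2; order
      have := w.injective (h (w i) hi)
      order
    exact ⟨hij.1.le.trans hj, hj⟩
  have hlen : (len w : ℤ) = ∑ i ∈ Finset.Icc 1 N, ∑ j ∈ Finset.Icc 1 N,
      if i < j ∧ w j < w i then (1 : ℤ) else 0 := by
    rw [len, hset, Set.ncard_coe_finset, Finset.card_filter, ← Finset.sum_product']
    push_cast
    rfl
  have hlen' : (len w : ℤ) = ∑ i ∈ Finset.Icc 1 N, ∑ j ∈ Finset.Icc 1 N,
      if j < i ∧ w i < w j then (1 : ℤ) else 0 := by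
    rw [hlen, Finset.sum_comm]
  rw [two_mul]
  nth_rewrite 1 [hlen]
  rw [hlen', ← Finset.sum_add_distrib]
  refine Finset.sum_congr rfl fun i _ => ?_
  rw [← Finset.sum_add_distrib]
  refine Finset.sum_congr rfl fun j _ => ?_
  unfold invInd
  grind

/-- As many arcs of `w` pass over a fixed point rightwards as leftwards. -/
theorem sum_arcSign_mul_overInd {N : ℕ+} {w : Equiv.Perm ℕ+} (h : FixAbove N w) {y : ℕ+}
    (hy : w y = y) :
    ∑ x ∈ Finset.Icc 1 N, arcSign x (w x) * overInd x (w x) y = 0 := by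
  have key : ∀ x, arcSign x (w x) * overInd x (w x) y =
      (if y < w x then (1 : ℤ) else 0) - (if y < x then (1 : ℤ) else 0) := by
    intro x
    rcases eq_or_ne x y with rfl | hxy
    · simp [arcSign, hy]
    · have : w x ≠ y := fun hh => hxy (w.injective (hh.trans hy.symm))
      unfold arcSign overInd
      grind
  simp only [key]
  rw [Finset.sum_sub_distrib, h.sum_comp (fun x => if y < x then (1 : ℤ) else 0), sub_self]

theorem arcSign_pairing_nonneg {x x' y y' : ℕ+} :
    0 ≤ arcSign x x' * arcSign y y' *
        (overInd x x' y + overInd x x' y' + overInd y y' x + overInd y y' x')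
      - 2 * (arcSign x x' * arcSign y y' * invInd x x' y y') := by
  unfold arcSign overInd invInd
  grind

theorem arcSign_pairing_pos {x x' y y' : ℕ+} (hc : SameCross x x' y y') :
    0 < arcSign x x' * arcSign y y' *
        (overInd x x' y + overInd x x' y' + overInd y y' x + overInd y y' x')
      - 2 * (arcSign x x' * arcSign y y' * invInd x x' y y') := by
  unfold arcSign overInd invInd
  unfold SameCross at hc
  grind

/-- The criterion for `u ≤_k w`. -/
structure KDominated (k : ℕ+) (u w : Equiv.Perm ℕ+) : Prop where
  up : ∀ i, i ≤ k → u i ≤ w i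
  down : ∀ i, k < i → w i ≤ u i
  mono : ∀ i j, i < j → (j ≤ k ∨ k < i) → u i < u j → w i < w j

theorem KDominated.refl (k : ℕ+) (u : Equiv.Perm ℕ+) : KDominated k u u :=
  ⟨fun _ _ => le_rfl, fun _ _ => le_rfl, fun _ _ _ _ h => h⟩

theorem KDominated.trans {k : ℕ+} {u v w : Equiv.Perm ℕ+} (h₁ : KDominated k u v)
    (h₂ : KDominated k v w) : KDominated k u w :=
  ⟨fun i hi => (h₁.up i hi).trans (h₂.up i hi),
    fun i hi => (h₂.down i hi).trans (h₁.down i hi),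
    fun i j hij hk h => h₂.mono i j hij hk (h₁.mono i j hij hk h)⟩

/-- Minus twice the rank of a permutation fixing every number above `N`. -/
def signedInv (N : ℕ+) (w : Equiv.Perm ℕ+) : ℤ :=
  ∑ x ∈ Finset.Icc 1 N, ∑ y ∈ Finset.Icc 1 N,
    arcSign x (w x) * arcSign y (w y) * invInd x (w x) y (w y)

theorem KDominated.two_mul_len_sub {k N : ℕ+} {u ζ : Equiv.Perm ℕ+}
    (h : KDominated k u (ζ * u)) (hu : FixAbove N u) (hζ : FixAbove N ζ) :
    2 * ((len (ζ * u) : ℤ) - len u) = - signedInv N ζ := by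
  have hsym : ∀ x x' y y', invInd x x' y y' = invInd y y' x x' := by
    intro x x' y y'
    unfold invInd
    grind
  let σ : ℕ+ → ℤ := fun i => if i ≤ k then 1 else -1
  let φ : ℕ+ → ℤ := fun i => if ζ (u i) = u i then σ i else 0
  let ε : ℕ+ → ℤ := fun i => arcSign (u i) (ζ (u i))
  let I : ℕ+ → ℕ+ → ℤ := fun i j => invInd (u i) (ζ (u i)) (u j) (ζ (u j))
  have hpair : ∀ i j, invInd i (ζ (u i)) j (ζ (u j)) - invInd i (u i) j (u j) =
      -(σ i * σ j * I i j) := by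
    have hlt : ∀ i j, i < j → invInd i (ζ (u i)) j (ζ (u j)) - invInd i (u i) j (u j) =
        -(σ i * σ j * I i j) := by
      intro i j hij
      have hne : u i ≠ u j := fun hh => hij.ne (u.injective hh)
      have hne' : ζ (u i) ≠ ζ (u j) := fun hh => hne (ζ.injective hh)
      have h1 := h.mono i j hij
      have h2 := h.up i
      have h3 := h.down i
      have h4 := h.up j
      have h5 := h.down j
      simp only [Equiv.Perm.mul_apply] at h1 h2 h3 h4 h5
      simp only [I, σ, invInd]
      clear hsym
      clear_value σ φ ε I
      generalize ζ (u i) = a at *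
      generalize ζ (u j) = b at *
      generalize u i = c at *
      generalize u j = d at *
      by_cases hi : i ≤ k <;> by_cases hj : j ≤ k <;> grind
    intro i j
    rcases lt_trichotomy i j with hij | rfl | hij
    · exact hlt i j hij
    · simp [I, invInd]
    · have := hlt j i hij
      simp only [I] at this ⊢
      rw [hsym i, hsym i, hsym (u i), this]
      ring
  have hσ : ∀ i, σ i = ε i + φ i := by
    intro i
    have h2 := h.up i
    have h3 := h.down i
    simp only [Equiv.Perm.mul_apply] at h2 h3
    simp only [σ, ε, φ, arcSign]
    grind
  have hφI : ∀ i, φ i * ∑ j ∈ Finset.Icc 1 N, ε j * I i j = 0 := by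
    intro i
    by_cases hi : ζ (u i) = u i
    · rw [mul_eq_zero]
      right
      rw [hu.sum_comp (fun y => arcSign y (ζ y) * invInd (u i) (ζ (u i)) y (ζ y)), hi,
        ← sum_arcSign_mul_overInd hζ hi]
      refine Finset.sum_congr rfl fun y _ => ?_
      congr 1
      unfold invInd overInd
      grind
    · simp [φ, hi]
  have hφφ : ∀ i j, φ i * φ j * I i j = 0 := by
    intro i j
    simp only [φ, I, invInd]
    grind
  have hsum : ∀ i j, σ i * σ j * I i j =
      ε i * ε j * I i j + φ i * (ε j * I i j) + φ j * (ε i * I j i) := by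
    intro i j
    have h1 := hφφ i j
    have h2 : I j i = I i j := hsym _ _ _ _
    rw [hσ i, hσ j, h2]
    linear_combination h1
  have hmain : ∑ i ∈ Finset.Icc 1 N, ∑ j ∈ Finset.Icc 1 N, σ i * σ j * I i j =
      signedInv N ζ := by
    simp only [hsum, Finset.sum_add_distrib, ← Finset.mul_sum, hφI]
    rw [Finset.sum_comm (f := fun i j => φ j * (ε i * I j i))]
    simp only [← Finset.mul_sum, hφI]
    simp only [Finset.sum_const_zero, add_zero, signedInv, ε, I]
    refine (Finset.sum_congr rfl fun i _ => hu.sum_comp fun y =>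
      arcSign (u i) (ζ (u i)) * arcSign y (ζ y) * invInd (u i) (ζ (u i)) y (ζ y)).trans ?_
    exact hu.sum_comp fun x => ∑ y ∈ Finset.Icc 1 N,
      arcSign x (ζ x) * arcSign y (ζ y) * invInd x (ζ x) y (ζ y)
  have e1 := sum_invInd_eq_two_mul_len (hζ.mul hu)
  have e2 := sum_invInd_eq_two_mul_len hu
  rw [mul_sub, ← e1, ← e2, ← hmain, ← Finset.sum_sub_distrib, ← Finset.sum_neg_distrib]
  refine Finset.sum_congr rfl fun i _ => ?_
  rw [← Finset.sum_sub_distrib, ← Finset.sum_neg_distrib]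
  exact Finset.sum_congr rfl fun j _ => hpair i j

/-- Twice the defect of additivity of the rank counts crossings in the same direction. -/
theorem not_sameCross_of_signedInv {N : ℕ+} {ζ η : Equiv.Perm ℕ+} (hζ : FixAbove N ζ)
    (hη : FixAbove N η) (hd : ζ.Disjoint η)
    (hadd : signedInv N (ζ * η) = signedInv N ζ + signedInv N η) (x y : ℕ+) :
    ¬ SameCross x (ζ x) y (η y) := by
  intro hc
  let T : ℕ+ → ℕ+ → ℤ := fun x y => arcSign x (ζ x) * arcSign y (η y)
  let F : ℕ+ → ℕ+ → ℤ := fun x y => T x y *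
        (overInd x (ζ x) y + overInd x (ζ x) (η y) + overInd y (η y) x + overInd y (η y) (ζ x))
      - 2 * (T x y * invInd x (ζ x) y (η y))
  have hdζ : ∀ y, η y ≠ y → ζ y = y ∧ ζ (η y) = η y := fun y hy =>
    ⟨(hd y).resolve_right hy, (hd (η y)).resolve_right fun hh => hy (η.injective hh)⟩
  have hdη : ∀ x, ζ x ≠ x → η x = x ∧ η (ζ x) = ζ x := fun x hx =>
    ⟨(hd x).resolve_left hx, (hd (ζ x)).resolve_left fun hh => hx (ζ.injective hh)⟩
  have hs0 : ∀ x, arcSign x x = 0 := fun x => by simp [arcSign]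
  -- the overlap terms cancel
  have o1 : ∑ x ∈ Finset.Icc 1 N, ∑ y ∈ Finset.Icc 1 N, T x y * overInd x (ζ x) y = 0 := by
    rw [Finset.sum_comm]
    refine Finset.sum_eq_zero fun y _ => ?_
    by_cases hy : η y = y
    · simp [T, hy, hs0]
    · rw [← mul_zero (arcSign y (η y)), ← sum_arcSign_mul_overInd hζ (hdζ y hy).1,
        Finset.mul_sum]
      exact Finset.sum_congr rfl fun x _ => by simp only [T]; ring
  have o2 : ∑ x ∈ Finset.Icc 1 N, ∑ y ∈ Finset.Icc 1 N, T x y * overInd x (ζ x) (η y) = 0 := by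
    rw [Finset.sum_comm]
    refine Finset.sum_eq_zero fun y _ => ?_
    by_cases hy : η y = y
    · simp [T, hy, hs0]
    · rw [← mul_zero (arcSign y (η y)), ← sum_arcSign_mul_overInd hζ (hdζ y hy).2,
        Finset.mul_sum]
      exact Finset.sum_congr rfl fun x _ => by simp only [T]; ring
  have o3 : ∑ x ∈ Finset.Icc 1 N, ∑ y ∈ Finset.Icc 1 N, T x y * overInd y (η y) x = 0 := by
    refine Finset.sum_eq_zero fun x _ => ?_
    by_cases hx : ζ x = x
    · simp [T, hx, hs0]
    · rw [← mul_zero (arcSign x (ζ x)), ← sum_arcSign_mul_overInd hη (hdη x hx).1,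
        Finset.mul_sum]
      exact Finset.sum_congr rfl fun y _ => by simp only [T]; ring
  have o4 : ∑ x ∈ Finset.Icc 1 N, ∑ y ∈ Finset.Icc 1 N, T x y * overInd y (η y) (ζ x) = 0 := by
    refine Finset.sum_eq_zero fun x _ => ?_
    by_cases hx : ζ x = x
    · simp [T, hx, hs0]
    · rw [← mul_zero (arcSign x (ζ x)), ← sum_arcSign_mul_overInd hη (hdη x hx).2,
        Finset.mul_sum]
      exact Finset.sum_congr rfl fun y _ => by simp only [T]; ring
  -- the defect of additivity
  have hdef : signedInv N (ζ * η) = signedInv N ζ + signedInv N η +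
      2 * ∑ x ∈ Finset.Icc 1 N, ∑ y ∈ Finset.Icc 1 N, T x y * invInd x (ζ x) y (η y) := by
    have hpt : ∀ x y, arcSign x ((ζ * η) x) * arcSign y ((ζ * η) y) *
          invInd x ((ζ * η) x) y ((ζ * η) y) =
        arcSign x (ζ x) * arcSign y (ζ y) * invInd x (ζ x) y (ζ y) +
        arcSign x (η x) * arcSign y (η y) * invInd x (η x) y (η y) +
        T x y * invInd x (ζ x) y (η y) + T y x * invInd y (ζ y) x (η x) := by
      intro x y
      have hsym : invInd x (η x) y (ζ y) = invInd y (ζ y) x (η x) := by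
        unfold invInd
        grind
      simp only [Equiv.Perm.mul_apply, T]
      by_cases hx : η x = x <;> by_cases hy : η y = y
      · simp [hx, hy, hs0]
      · simp only [hx, (hdζ y hy).1, (hdζ y hy).2, hs0]
        ring
      · simp only [hy, (hdζ x hx).1, (hdζ x hx).2, hs0]
        rw [hy] at *
        rw [hsym]
        ring
      · simp only [(hdζ x hx).1, (hdζ x hx).2, (hdζ y hy).1, (hdζ y hy).2, hs0]
        ring
    simp only [signedInv, hpt, Finset.sum_add_distrib]
    rw [Finset.sum_comm (f := fun x y => T y x * invInd y (ζ y) x (η x))]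
    ring
  have hF : ∑ x ∈ Finset.Icc 1 N, ∑ y ∈ Finset.Icc 1 N, F x y = 0 := by
    simp only [F, mul_add, Finset.sum_sub_distrib, Finset.sum_add_distrib, ← Finset.mul_sum,
      o1, o2, o3, o4]
    linarith
  have hF0 : ∀ x y, 0 ≤ F x y := fun x y => arcSign_pairing_nonneg
  have hx : x ∈ Finset.Icc 1 N := by
    rw [Finset.mem_Icc]
    refine ⟨one_le, ?_⟩
    by_contra hlt
    rw [hζ x (not_le.mp hlt)] at hc
    unfold SameCross at hc
    grind
  have hy : y ∈ Finset.Icc 1 N := by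
    rw [Finset.mem_Icc]
    refine ⟨one_le, ?_⟩
    by_contra hlt
    rw [hη y (not_le.mp hlt)] at hc
    unfold SameCross at hc
    grind
  have h1 := (Finset.sum_eq_zero_iff_of_nonneg
    fun x _ => Finset.sum_nonneg fun y _ => hF0 x y).1 hF x hx
  have h2 := (Finset.sum_eq_zero_iff_of_nonneg fun y _ => hF0 x y).1 h1 y hy
  exact (arcSign_pairing_pos hc).ne' h2

theorem kDominated_mul_swap {k a b : ℕ+} {u : Equiv.Perm ℕ+} (ha : a ≤ k) (hb : k < b)
    (hab : u a < u b) (hgap : ∀ c, a < c → c < b → ¬ (u a < u c ∧ u c < u b)) :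
    KDominated k u (u * Equiv.swap a b) := by
  have hval : ∀ i, (u * Equiv.swap a b) i = if i = a then u b else if i = b then u a else u i := by
    intro i
    rw [Equiv.Perm.mul_apply, Equiv.swap_apply_def]
    split_ifs <;> rfl
  refine ⟨fun i hi => ?_, fun i hi => ?_, fun i j hij hk hu => ?_⟩
  · rw [hval]
    grind
  · rw [hval]
    grind
  · have h1 := hgap i
    have h2 := hgap j
    have h3 : u i = u b → i = b := fun h => u.injective h
    have h4 : u j = u b → j = b := fun h => u.injective h
    have h5 : u i = u a → i = a := fun h => u.injective h
    have h6 : u j = u a → j = a := fun h => u.injective h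
    rw [hval, hval]
    grind

theorem signedInv_swap {N x y : ℕ+} (hxy : x < y) (hy : y ≤ N) :
    signedInv N (Equiv.swap x y) = -2 := by
  have hpt : ∀ p q, arcSign p (Equiv.swap x y p) * arcSign q (Equiv.swap x y q) *
      invInd p (Equiv.swap x y p) q (Equiv.swap x y q) =
      (if p = x then (if q = y then (-1 : ℤ) else 0) else 0) +
      (if p = y then (if q = x then (-1 : ℤ) else 0) else 0) := by
    intro p q
    simp only [Equiv.swap_apply_def, arcSign, invInd]
    grind
  have hx' : x ∈ Finset.Icc 1 N := Finset.mem_Icc.mpr ⟨one_le, hxy.le.trans hy⟩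
  have hy' : y ∈ Finset.Icc 1 N := Finset.mem_Icc.mpr ⟨one_le, hy⟩
  simp only [signedInv, hpt, Finset.sum_add_distrib]
  have hin : ∀ (p z t : ℕ+), t ∈ Finset.Icc 1 N → ∑ q ∈ Finset.Icc 1 N,
      (if p = z then (if q = t then (-1 : ℤ) else 0) else 0) = if p = z then -1 else 0 := by
    intro p z t ht
    by_cases hp : p = z
    · simp only [hp, if_true, Finset.sum_ite_eq', ht]
    · simp [hp]
  simp only [hin _ _ _ hx', hin _ _ _ hy', Finset.sum_ite_eq', hx', hy', if_true]
  norm_num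

theorem len_mul_swap {a b : ℕ+} {u : Equiv.Perm ℕ+} (hu : FinSupp u) (hlt : a < b)
    (hab : u a < u b) (hgap : ∀ c, a < c → c < b → ¬ (u a < u c ∧ u c < u b)) :
    len (u * Equiv.swap a b) = len u + 1 := by
  have hdom := kDominated_mul_swap le_rfl hlt hab hgap
  rw [Equiv.mul_swap_eq_swap_mul] at hdom ⊢
  obtain ⟨N, hN⟩ := hu.exists_fixAbove
  have hM : FixAbove (max N (u b)) (Equiv.swap (u a) (u b)) := fun x hx => by
    have := (le_max_right N (u b)).trans_lt hx
    exact Equiv.swap_apply_of_ne_of_ne (hab.trans this).ne' this.ne'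
  have := hdom.two_mul_len_sub (hN.mono (le_max_left _ _)) hM
  rw [signedInv_swap hab (le_max_right _ _)] at this
  omega

theorem len_lt_len_mul_swap_aux (n : ℕ) : ∀ {a b : ℕ+} {u : Equiv.Perm ℕ+}, (b : ℕ) - a = n →
    FinSupp u → a < b → u a < u b → len u < len (u * Equiv.swap a b) ∧
      (len (u * Equiv.swap a b) = len u + 1 →
        ∀ c, a < c → c < b → ¬ (u a < u c ∧ u c < u b)) := by
  induction n using Nat.strong_induction_on with
  | _ n ih =>
    intro a b u hn hu hlt hab
    by_cases hgap : ∀ c, a < c → c < b → ¬ (u a < u c ∧ u c < u b)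
    · rw [len_mul_swap hu hlt hab hgap]
      exact ⟨Nat.lt_succ_self _, fun _ => hgap⟩
    · push Not at hgap
      obtain ⟨c, hac, hcb, h1, h2⟩ := hgap
      have hac' : (a : ℕ) < c := hac
      have hcb' : (c : ℕ) < b := hcb
      have s1 := Equiv.swap_apply_of_ne_of_ne (hac.trans hcb).ne' hcb.ne'
      have s2 : Equiv.swap c b a = a := Equiv.swap_apply_of_ne_of_ne hac.ne (hac.trans hcb).ne
      have i1 : len u < len (u * Equiv.swap a c) := (ih _ (by omega) rfl hu hac h1).1
      have i2 : len (u * Equiv.swap a c) < len (u * Equiv.swap a c * Equiv.swap c b) := by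
        refine (ih _ (by omega) rfl (hu.mul (finSupp_swap a c)) hcb ?_).1
        simpa [s1] using hab
      have i3 : len (u * Equiv.swap a c * Equiv.swap c b) <
          len (u * Equiv.swap a c * Equiv.swap c b * Equiv.swap a c) := by
        refine (ih _ (by omega) rfl
          ((hu.mul (finSupp_swap a c)).mul (finSupp_swap c b)) hac ?_).1
        simpa [s1, s2] using h2
      have hprod : Equiv.swap a c * Equiv.swap c b * Equiv.swap a c = Equiv.swap a b := by
        rw [Equiv.swap_comm a c, Equiv.swap_comm c b]
        exact Equiv.swap_mul_swap_mul_swap hcb.ne' (hac.trans hcb).ne'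
      have i4 : u * Equiv.swap a c * Equiv.swap c b * Equiv.swap a c = u * Equiv.swap a b := by
        rw [← hprod]
        simp only [mul_assoc]
      rw [i4] at i3
      exact ⟨by omega, by omega⟩

theorem kBruhatCov.kDominated {k : ℕ+} {u w : Equiv.Perm ℕ+} (hu : FinSupp u)
    (h : kBruhatCov k u w) : KDominated k u w := by
  obtain ⟨a, b, ha, hb, rfl, hlen⟩ := h
  have hlt : a < b := ha.trans_lt hb
  have hab : u a < u b := by
    by_contra hle
    have hne : u a ≠ u b := fun hh => hlt.ne (u.injective hh)
    have := (len_lt_len_mul_swap_aux _ rfl (hu.mul (finSupp_swap a b)) hlt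
      (by simpa using lt_of_le_of_ne (not_lt.mp hle) hne.symm)).1
    rw [mul_assoc, Equiv.swap_mul_self, mul_one] at this
    omega
  exact kDominated_mul_swap ha hb hab ((len_lt_len_mul_swap_aux _ rfl hu hlt hab).2 hlen)

theorem kBruhat.kDominated {k : ℕ+} {u w : Equiv.Perm ℕ+} (hu : FinSupp u)
    (h : kBruhat k u w) : FinSupp w ∧ KDominated k u w := by
  induction h with
  | refl => exact ⟨hu, .refl k u⟩
  | tail _ hc ih =>
    refine ⟨?_, ih.2.trans (hc.kDominated ih.1)⟩
    obtain ⟨a, b, -, -, rfl, -⟩ := hc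
    exact ih.1.mul (finSupp_swap a b)

theorem mem_of_apply_mem {f : Equiv.Perm ℕ+} {S : Finset ℕ+} (hS : ∀ z ∈ S, f z ∈ S) {z : ℕ+}
    (hz : f z ∈ S) : z ∈ S := by
  simpa using Equiv.Perm.perm_symm_on_of_perm_on_finset hS hz

theorem KDominated.exists_cov {k : ℕ+} {u w : Equiv.Perm ℕ+} (h : KDominated k u w)
    (hne : u ≠ w) : ∃ a b, a ≤ k ∧ k < b ∧ u a < u b ∧
      (∀ c, a < c → c < b → ¬ (u a < u c ∧ u c < u b)) ∧
      KDominated k (u * Equiv.swap a b) w := by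
  let ζ := w * u⁻¹
  have hζ : ∀ i, ζ (u i) = w i := fun i => by simp [ζ]
  have hex : ∃ a, a ≤ k ∧ u a < w a := by
    by_contra! hcon
    have hle : ∀ z, ζ z ≤ z := by
      intro z
      obtain ⟨i, rfl⟩ := u.surjective z
      rw [hζ]
      rcases le_or_gt i k with hi | hi
      · exact hcon i hi
      · exact h.down i hi
    refine hne (Equiv.ext fun i => ?_)
    by_contra hi
    have hlt : ζ (u i) < u i := lt_of_le_of_ne (hle _) (by rw [hζ]; exact fun hh => hi hh.symm)
    have hS : ∀ z ∈ Finset.Icc 1 (ζ (u i)), ζ z ∈ Finset.Icc 1 (ζ (u i)) := fun z hz =>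
      Finset.mem_Icc.mpr ⟨one_le, (hle z).trans (Finset.mem_Icc.mp hz).2⟩
    have := mem_of_apply_mem hS (Finset.mem_Icc.mpr ⟨one_le, le_rfl⟩)
    exact absurd (Finset.mem_Icc.mp this).2 (not_le.mpr hlt)
  obtain ⟨a, ⟨hak, ha⟩, hamax⟩ : ∃ a, (a ≤ k ∧ u a < w a) ∧
      ∀ c, c ≤ k → u c < w c → u c ≤ u a := by
    obtain ⟨a₀, h0⟩ := hex
    obtain ⟨a, ha, hmax⟩ := Finset.exists_max_image
      ((Finset.Icc 1 k).filter fun i => u i < w i) u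
      ⟨a₀, by simpa using h0⟩
    refine ⟨a, by simpa using ha, fun c hc hcw => hmax c (by simpa using ⟨hc, hcw⟩)⟩
  have hexb : ∃ b, w b ≤ u a ∧ u a < u b := by
    by_contra! hcon
    have hS : ∀ z ∈ Finset.Icc 1 (u a), ζ.symm z ∈ Finset.Icc 1 (u a) := by
      intro z hz
      obtain ⟨i, rfl⟩ := w.surjective z
      rw [← hζ, Equiv.symm_apply_apply]
      exact Finset.mem_Icc.mpr ⟨one_le, hcon i (Finset.mem_Icc.mp hz).2⟩
    have : ζ.symm (w a) ∈ Finset.Icc 1 (u a) := by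
      rw [← hζ, Equiv.symm_apply_apply]
      exact Finset.mem_Icc.mpr ⟨one_le, le_rfl⟩
    exact absurd (Finset.mem_Icc.mp (mem_of_apply_mem hS this)).2 (not_le.mpr ha)
  obtain ⟨b, ⟨hb1, hb2⟩, hbmin⟩ :=
    WellFounded.has_min (InvImage.wf u wellFounded_lt) {b | w b ≤ u a ∧ u a < u b} hexb
  have hbmin' : ∀ c, u a < u c → u c < u b → u a < w c := fun c h1 h2 => by
    by_contra h3
    exact hbmin c ⟨not_lt.mp h3, h1⟩ h2
  have hkb : k < b := by
    by_contra hle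
    have := h.up b (not_lt.mp hle)
    order
  have hba : u b ≤ w a := by
    by_contra hlt
    have hS : ∀ z ∈ Finset.Ioo (u a) (u b), ζ z ∈ Finset.Ioo (u a) (u b) := by
      intro z hz
      obtain ⟨i, rfl⟩ := u.surjective z
      rw [Finset.mem_Ioo] at hz
      rw [hζ, Finset.mem_Ioo]
      rcases le_or_gt i k with hi | hi
      · have h1 := h.up i hi
        have h2 := hamax i hi
        grind
      · exact ⟨hbmin' i hz.1 hz.2, (h.down i hi).trans_lt hz.2⟩
    have : ζ (u a) ∈ Finset.Ioo (u a) (u b) := by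
      rw [hζ]
      exact Finset.mem_Ioo.mpr ⟨ha, not_le.mp hlt⟩
    exact absurd (Finset.mem_Ioo.mp (mem_of_apply_mem hS this)).1 (lt_irrefl _)
  have hval : ∀ i, (u * Equiv.swap a b) i = if i = a then u b else if i = b then u a else u i := by
    intro i
    rw [Equiv.Perm.mul_apply, Equiv.swap_apply_def]
    split_ifs <;> rfl
  refine ⟨a, b, hak, hkb, hb2, fun c hac hcb hc => ?_, fun i hi => ?_, fun i hi => ?_,
    fun i j hij hk hlt => ?_⟩
  · rcases le_or_gt c k with hck | hck
    · have h1 := h.mono a c hac (Or.inl hck) hc.1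
      have h2 := h.up c hck
      have h3 := hamax c hck
      grind
    · have h1 := h.mono c b hcb (Or.inr hck) hc.2
      have h2 := hbmin' c hc.1 hc.2
      order
  · rw [hval]
    have := h.up i hi
    grind
  · rw [hval]
    have := h.down i hi
    grind
  · rw [hval, hval] at hlt
    have h1 := h.mono i j hij hk
    have h2 := h.up i
    have h3 := hamax i
    have h4 := hbmin' j
    have h5 : u i = u a → i = a := fun h => u.injective h
    have h6 : u j = u b → j = b := fun h => u.injective h
    grind

theorem KDominated.kBruhat {k : ℕ+} {w : Equiv.Perm ℕ+} (n : ℕ) : ∀ {u : Equiv.Perm ℕ+},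
    FinSupp u → KDominated k u w →
    ∑ i ∈ Finset.Icc 1 k, ((w i : ℕ) - (u i : ℕ)) = n → kBruhat k u w := by
  induction n using Nat.strong_induction_on with
  | _ n ih =>
    intro u hu h hn
    by_cases hne : u = w
    · rw [hne]
      exact Relation.ReflTransGen.refl
    · obtain ⟨a, b, ha, hb, hab, hgap, hdom⟩ := h.exists_cov hne
      have hcov : kBruhatCov k u (u * Equiv.swap a b) :=
        ⟨a, b, ha, hb, rfl, len_mul_swap hu (ha.trans_lt hb) hab hgap⟩
      refine Relation.ReflTransGen.head hcov
        (ih _ ?_ (hu.mul (finSupp_swap a b)) hdom rfl)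
      rw [← hn]
      have hstep := kDominated_mul_swap ha hb hab hgap
      refine Finset.sum_lt_sum (fun i hi => ?_) ⟨a, Finset.mem_Icc.mpr ⟨one_le, ha⟩, ?_⟩
      · have : (u i : ℕ) ≤ (u * Equiv.swap a b) i := hstep.up i (Finset.mem_Icc.mp hi).2
        omega
      · have h1 : (u * Equiv.swap a b) a ≤ w a := hdom.up a ha
        rw [Equiv.Perm.mul_apply, Equiv.swap_apply_left] at h1 ⊢
        have h2 : (u a : ℕ) < u b := hab
        have h3 : (u b : ℕ) ≤ w a := h1
        omega

theorem kBruhat_iff {k : ℕ+} {u w : Equiv.Perm ℕ+} (hu : FinSupp u) :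
    kBruhat k u w ↔ KDominated k u w :=
  ⟨fun h => (h.kDominated hu).2, fun h => h.kBruhat _ hu rfl⟩

theorem exists_grassmannian {N : ℕ+} {V : Set ℕ+} (hV : ∀ x ∈ V, x ≤ N) (hne : V.Nonempty) :
    ∃ (v : Equiv.Perm ℕ+) (k : ℕ+), FinSupp v ∧ (∀ i, i ≤ k ↔ v i ∈ V) ∧
      ∀ i j, i < j → (j ≤ k ∨ k < i) → v i < v j := by
  classical
  let s : Finset ℕ+ := Finset.Icc 1 N
  have hs : ∀ x, x ∈ s ↔ x ≤ N := fun x => by simp [s]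
  let key : ℕ+ → ℕ+ := fun x => if x ∈ V then x else x + N
  let ι := s.orderIsoOfFin rfl
  let σ := Tuple.sort (fun i => key (ι i))
  let v : Equiv.Perm ℕ+ := σ.extendDomain ι.toEquiv
  have hfix : FixAbove N v := fun x hx =>
    Equiv.Perm.extendDomain_apply_not_subtype _ _ (by rw [hs]; exact not_le.mpr hx)
  have hvs : ∀ x, x ≤ N ↔ v x ≤ N := fun x => by rw [← hs, ← hs]; exact hfix.mem_iff x
  have hkey : ∀ x y, x ≤ N → y ≤ N → key x = key y → x = y := by
    intro x y hx hy hxy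
    have h1 : N < x + N := PNat.lt_add_left N x
    have h2 : N < y + N := PNat.lt_add_left N y
    simp only [key] at hxy
    split_ifs at hxy
    · exact hxy
    · order
    · order
    · exact add_right_cancel hxy
  have hmono : ∀ i j, i < j → j ≤ N → key (v i) < key (v j) := by
    intro i j hij hj
    have hi : i ≤ N := hij.le.trans hj
    obtain ⟨p, hp⟩ := ι.surjective ⟨i, (hs i).2 hi⟩
    obtain ⟨q, hq⟩ := ι.surjective ⟨j, (hs j).2 hj⟩
    have hp' : i = ι p := by rw [hp]
    have hq' : j = ι q := by rw [hq]
    have hpv : v i = ι (σ p) := by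
      rw [hp']
      exact Equiv.Perm.extendDomain_apply_image σ ι.toEquiv p
    have hqv : v j = ι (σ q) := by
      rw [hq']
      exact Equiv.Perm.extendDomain_apply_image σ ι.toEquiv q
    have hpq : p ≤ q := by
      rw [← ι.le_iff_le, ← Subtype.coe_le_coe, ← hp', ← hq']
      exact hij.le
    refine lt_of_le_of_ne ?_ fun h => hij.ne (v.injective
      (hkey _ _ ((hvs i).1 hi) ((hvs j).1 hj) h))
    rw [hpv, hqv]
    exact Tuple.monotone_sort (fun i => key (ι i)) hpq
  obtain ⟨x₀, hx₀⟩ := hne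
  have hmem : ∀ i, i ∈ s.filter (fun i => v i ∈ V) ↔ v i ∈ V := fun i => by
    rw [Finset.mem_filter, hs, hvs, and_iff_right_iff_imp]
    exact hV _
  obtain ⟨k, hk, hmax⟩ := Finset.exists_max_image (s.filter (fun i => v i ∈ V)) id
    ⟨v.symm x₀, by rw [hmem]; simpa using hx₀⟩
  have hkV := (hmem k).1 hk
  have hkN : k ≤ N := (hvs k).2 (hV _ hkV)
  have hik : ∀ i, i ≤ k ↔ v i ∈ V := by
    refine fun i => ⟨fun hi => ?_, fun hi => hmax i ((hmem i).2 hi)⟩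
    rcases eq_or_lt_of_le hi with rfl | hlt
    · exact hkV
    · by_contra hiV
      have h1 := hmono i k hlt hkN
      have h2 : N < v i + N := PNat.lt_add_left N _
      have h3 := hV _ hkV
      simp only [key, hkV, hiV, if_true, if_false] at h1
      order
  refine ⟨v, k, hfix.finSupp, hik, fun i j hij hk => ?_⟩
  by_cases hj : j ≤ N
  · have h1 := hmono i j hij hj
    rcases hk with hk | hk
    · have hi := (hik i).1 (hij.le.trans hk)
      have hj := (hik j).1 hk
      simpa only [key, hi, hj, if_true] using h1
    · have hi := (hik i).not.1 (not_le.mpr hk)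
      have hj := (hik j).not.1 (not_le.mpr (hk.trans hij))
      simp only [key, hi, hj, if_false] at h1
      exact lt_of_add_lt_add_right h1
  · rw [hfix j (not_le.mp hj)]
    by_cases hi : i ≤ N
    · exact ((hvs i).1 hi).trans_lt (not_le.mp hj)
    · rwa [hfix i (not_le.mp hi)]

/-- The criterion for `η ⪯ ζ`. -/
structure OrderCriterion (η ζ : Equiv.Perm ℕ+) : Prop where
  up : ∀ x, x ≤ ζ x → x ≤ η x ∧ η x ≤ ζ x
  down : ∀ x, ζ x ≤ x → ζ x ≤ η x ∧ η x ≤ x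
  mono : ∀ x y, x < y → ζ x < ζ y → (x < ζ x ∧ y < ζ y) ∨ (ζ x < x ∧ ζ y < y) → η x < η y

theorem OrderCriterion.apply_eq {η ζ : Equiv.Perm ℕ+} (h : OrderCriterion η ζ) {x : ℕ+}
    (hx : ζ x = x) : η x = x :=
  le_antisymm (h.down x hx.le).2 (h.up x hx.ge).1

theorem OrderCriterion.finSupp {η ζ : Equiv.Perm ℕ+} (h : OrderCriterion η ζ)
    (hζ : FinSupp ζ) : FinSupp η :=
  hζ.subset fun _ hx hx' => hx (h.apply_eq hx')

theorem OrderCriterion.mono_weak {η ζ : Equiv.Perm ℕ+} (h : OrderCriterion η ζ) {x y : ℕ+}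
    (hxy : x < y) (hζ : ζ x < ζ y) (hdir : (x ≤ ζ x ∧ y ≤ ζ y) ∨ (ζ x ≤ x ∧ ζ y ≤ y)) :
    η x < η y := by
  have h1 := h.mono x y hxy hζ
  have h2 := h.up x
  have h3 := h.down x
  have h4 := h.up y
  have h5 := h.down y
  grind

theorem newOrder_iff {η ζ : Equiv.Perm ℕ+} :
    NewOrder η ζ ↔ FinSupp ζ ∧ OrderCriterion η ζ := by
  constructor
  · rintro ⟨u, k, hu, h1, h2⟩
    obtain ⟨hηu, d1⟩ := h1.kDominated hu
    obtain ⟨hζu, d2⟩ := h2.kDominated hηu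
    have hup : ∀ i, i ≤ k → u i ≤ η (u i) ∧ η (u i) ≤ ζ (u i) := fun i hi =>
      ⟨d1.up i hi, d2.up i hi⟩
    have hdown : ∀ i, k < i → ζ (u i) ≤ η (u i) ∧ η (u i) ≤ u i := fun i hi =>
      ⟨d2.down i hi, d1.down i hi⟩
    refine ⟨by simpa using hζu.mul hu.inv, fun x hx => ?_, fun x hx => ?_,
      fun x y hxy hζ hdir => ?_⟩
    · obtain ⟨i, rfl⟩ := u.surjective x
      have h1 := hup i
      have h2 := hdown i
      grind
    · obtain ⟨i, rfl⟩ := u.surjective x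
      have h1 := hup i
      have h2 := hdown i
      grind
    · obtain ⟨i, rfl⟩ := u.surjective x
      obtain ⟨j, rfl⟩ := u.surjective y
      have a1 := hup i
      have a2 := hdown i
      have a3 := hup j
      have a4 := hdown j
      have a5 := d1.mono i j
      have a6 := d2.mono j i
      have a7 : η (u i) = η (u j) → u i = u j := fun hh => η.injective hh
      have a8 : i = j → u i = u j := fun hh => by rw [hh]
      simp only [Equiv.Perm.mul_apply] at a5 a6
      have hside : (i ≤ k ∧ j ≤ k) ∨ (k < i ∧ k < j) := by
        rcases le_or_gt i k with hi | hi <;> rcases le_or_gt j k with hj | hj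
        · exact Or.inl ⟨hi, hj⟩
        · have b1 := (a1 hi).1.trans (a1 hi).2
          have b2 := (a4 hj).1.trans (a4 hj).2
          exact (hdir.elim (fun h => h.2.not_ge b2) fun h => h.1.not_ge b1).elim
        · have b1 := (a2 hi).1.trans (a2 hi).2
          have b2 := (a3 hj).1.trans (a3 hj).2
          exact (hdir.elim (fun h => h.1.not_ge b1) fun h => h.2.not_ge b2).elim
        · exact Or.inr ⟨hi, hj⟩
      rcases lt_trichotomy i j with hij | hij | hij
      · exact a5 hij (hside.imp And.right And.left) hxy
      · exact absurd (a8 hij) hxy.ne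
      · by_contra hle
        have hne : η (u i) ≠ η (u j) := fun hh => hxy.ne (a7 hh)
        exact (a6 hij (hside.imp And.left And.right)
          (lt_of_le_of_ne (not_lt.mp hle) hne.symm)).not_gt hζ
  · rintro ⟨hζ, h⟩
    obtain ⟨N, hN⟩ := hζ.exists_fixAbove
    obtain ⟨v, k, hv, hk, hvmono⟩ := exists_grassmannian (N := N)
      (V := {z | z ≤ N ∧ ζ.symm z ≤ z}) (fun x hx => hx.1)
      ⟨ζ 1, by simpa using (hN.mem_iff 1).1 (by simp), by simp⟩
    have hηu : FinSupp (ζ⁻¹ * v) := hζ.inv.mul hv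
    have hζu : ∀ i, ζ ((ζ⁻¹ * v) i) = v i := fun i => by simp
    have hup : ∀ i, i ≤ k → (ζ⁻¹ * v) i ≤ ζ ((ζ⁻¹ * v) i) := fun i hi => by
      rw [hζu]
      exact ((hk i).1 hi).2
    have hdown : ∀ i, k < i → ζ ((ζ⁻¹ * v) i) ≤ (ζ⁻¹ * v) i := fun i hi => by
      by_contra hlt
      rw [not_le] at hlt
      have h1 : v i ≤ N := by
        by_contra hlt'
        rw [not_le] at hlt'
        have := hN _ hlt'
        rw [← hζu i] at this
        exact hlt.ne (ζ.injective this).symm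
      rw [hζu] at hlt
      exact (hk i).not.1 (not_le.mpr hi) ⟨h1, hlt.le⟩
    refine ⟨ζ⁻¹ * v, k, hηu, ?_, ?_⟩
    · rw [kBruhat_iff hηu]
      refine ⟨fun i hi => (h.up _ (hup i hi)).1, fun i hi => (h.down _ (hdown i hi)).2,
        fun i j hij hk hlt => h.mono_weak hlt ?_ ?_⟩
      · rw [hζu, hζu]
        exact hvmono i j hij hk
      · rcases hk with hk | hk
        · exact Or.inl ⟨hup i (hij.le.trans hk), hup j hk⟩
        · exact Or.inr ⟨hdown i hk, hdown j (hk.trans hij)⟩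
    · rw [kBruhat_iff ((h.finSupp hζ).mul hηu)]
      refine ⟨fun i hi => (h.up _ (hup i hi)).2, fun i hi => (h.down _ (hdown i hi)).1,
        fun i j hij hk _ => ?_⟩
      change ζ ((ζ⁻¹ * v) i) < ζ ((ζ⁻¹ * v) j)
      rw [hζu, hζu]
      exact hvmono i j hij hk

/-- `y` lies strictly under the arc `x → x'`. -/
def Under (x x' y : ℕ+) : Prop := (x < y ∧ y < x') ∨ (x' < y ∧ y < x)

/-- Without crossings in the same direction, a leftward arc of `ζ` lies over both ends of an arc
of `η` or over neither. -/
theorem left_arc_over_iff {ζ η : Equiv.Perm ℕ+} (hζ : FinSupp ζ) (hη : FinSupp η)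
    (hd : ζ.Disjoint η) (hc : ∀ x y, ¬ SameCross x (ζ x) y (η y)) (x y : ℕ+) (hy : η y ≠ y) :
    (ζ x < y ∧ y < x) ↔ (ζ x < η y ∧ η y < x) := by
  obtain ⟨N₁, hN₁⟩ := hζ.exists_fixAbove
  obtain ⟨N₂, hN₂⟩ := hη.exists_fixAbove
  obtain ⟨N, hNζ, hNη⟩ : ∃ N, FixAbove N ζ ∧ FixAbove N η :=
    ⟨max N₁ N₂, hN₁.mono (le_max_left _ _), hN₂.mono (le_max_right _ _)⟩
  have hdζ : ∀ y, η y ≠ y → ζ y = y ∧ ζ (η y) = η y := fun y hy =>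
    ⟨(hd y).resolve_right hy, (hd (η y)).resolve_right fun hh => hy (η.injective hh)⟩
  -- distinctness of endpoints
  have hne : ∀ x y, η y ≠ y → ζ x ≠ x → x ≠ y ∧ x ≠ η y ∧ ζ x ≠ y ∧ ζ x ≠ η y := by
    intro x y hy hx
    obtain ⟨h1, h2⟩ := hdζ y hy
    refine ⟨?_, ?_, fun h => ?_, fun h => ?_⟩
    · rintro rfl; exact hx h1
    · rintro rfl; exact hx h2
    · rw [← h] at h1; exact hx (ζ.injective h1)
    · rw [← h] at h2; exact hx (ζ.injective h2)
  let L : ℕ+ → ℕ+ → ℤ := fun x y => if ζ x < y ∧ y < x then 1 else 0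
  let R : ℕ+ → ℕ+ → ℤ := fun x y => if x < y ∧ y < ζ x then 1 else 0
  have hLR : ∀ y, ζ y = y →
      ∑ x ∈ Finset.Icc 1 N, L x y = ∑ x ∈ Finset.Icc 1 N, R x y := by
    intro y hy
    rw [eq_comm, ← sub_eq_zero, ← Finset.sum_sub_distrib, ← sum_arcSign_mul_overInd hNζ hy]
    refine Finset.sum_congr rfl fun x _ => ?_
    simp only [L, R, arcSign, overInd]
    grind
  have hR : ∀ x y, y < η y → R x y = R x (η y) := by
    intro x y hy
    have h1 := hc x y
    have h2 := hne x y hy.ne'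
    simp only [R]
    unfold SameCross at h1
    grind
  have hL : ∀ x y, η y < y → L x y = L x (η y) := by
    intro x y hy
    have h1 := hc x y
    have h2 := hne x y hy.ne
    simp only [L]
    unfold SameCross at h1
    grind
  let Φ : ℕ+ → ℤ := fun y => ∑ x ∈ Finset.Icc 1 N, L x y * ((ζ x : ℕ) : ℤ)
  have hterm : ∀ x y, y < η y → 0 ≤ (L x (η y) - L x y) * (((ζ x : ℕ) : ℤ) - ((y : ℕ) : ℤ)) ∧
      ((L x (η y) - L x y) * (((ζ x : ℕ) : ℤ) - ((y : ℕ) : ℤ)) = 0 → L x (η y) = L x y) := by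
    intro x y hy
    have h2 := hne x y hy.ne'
    simp only [L]
    have h3 : ζ x < y ↔ ((ζ x : ℕ) : ℤ) < ((y : ℕ) : ℤ) := by
      rw [Nat.cast_lt, PNat.coe_lt_coe]
    have h4 : y < ζ x ↔ ((y : ℕ) : ℤ) < ((ζ x : ℕ) : ℤ) := by
      rw [Nat.cast_lt, PNat.coe_lt_coe]
    grind
  have hΦ : ∀ y, y < η y → Φ (η y) - Φ y =
      ∑ x ∈ Finset.Icc 1 N, (L x (η y) - L x y) * (((ζ x : ℕ) : ℤ) - ((y : ℕ) : ℤ)) := by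
    intro y hy
    obtain ⟨h1, h2⟩ := hdζ y hy.ne'
    have h3 : ∑ x ∈ Finset.Icc 1 N, L x (η y) = ∑ x ∈ Finset.Icc 1 N, L x y := by
      rw [hLR y h1, hLR _ h2]
      exact Finset.sum_congr rfl fun x _ => (hR x y hy).symm
    simp only [mul_sub, sub_mul, Finset.sum_sub_distrib, ← Finset.sum_mul, h3, Φ]
    ring
  have hΦnonneg : ∀ y, 0 ≤ Φ (η y) - Φ y := by
    intro y
    rcases lt_trichotomy y (η y) with h | h | h
    · rw [hΦ y h]
      exact Finset.sum_nonneg fun x _ => (hterm x y h).1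
    · rw [← h, sub_self]
    · simp only [Φ, hL _ y h, sub_self, le_refl]
  have hΦsum : ∑ y ∈ Finset.Icc 1 N, (Φ (η y) - Φ y) = 0 := by
    rw [Finset.sum_sub_distrib, hNη.sum_comp Φ, sub_self]
  have hmem : ∀ {w : Equiv.Perm ℕ+}, FixAbove N w → ∀ z, w z ≠ z → z ∈ Finset.Icc 1 N := by
    intro w hw z hz
    rw [Finset.mem_Icc]
    exact ⟨one_le, not_lt.mp fun hlt => hz (hw z hlt)⟩
  have hLeq : L x y = L x (η y) := by
    rcases lt_or_gt_of_ne hy with h | h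
    · exact hL x y h
    · have h0 := (Finset.sum_eq_zero_iff_of_nonneg fun y _ => hΦnonneg y).1 hΦsum y
        (hmem hNη y hy)
      rw [hΦ y h] at h0
      by_cases hx : ζ x = x
      · simp only [L, hx]
        grind
      · exact ((hterm x y h).2 ((Finset.sum_eq_zero_iff_of_nonneg
          fun x _ => (hterm x y h).1).1 h0 x (hmem hNζ x hx))).symm
  simp only [L] at hLeq
  grind

/-- Arcs of `ζ` and `η` do not cross. -/
theorem under_iff_under_apply {ζ η : Equiv.Perm ℕ+} (hζ : FinSupp ζ) (hη : FinSupp η)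
    (hd : ζ.Disjoint η) (hc : ∀ x y, ¬ SameCross x (ζ x) y (η y)) (x y : ℕ+) (hy : η y ≠ y) :
    Under x (ζ x) y ↔ Under x (ζ x) (η y) := by
  have h1 := left_arc_over_iff hζ hη hd hc x y hy
  have hc' : ∀ x y, ¬ SameCross x (ζ⁻¹ x) y (η⁻¹ y) := by
    intro x y h
    obtain ⟨x, rfl⟩ := ζ.surjective x
    obtain ⟨y, rfl⟩ := η.surjective y
    have := hc x y
    rw [Equiv.Perm.inv_def, Equiv.Perm.inv_def, Equiv.symm_apply_apply,
      Equiv.symm_apply_apply] at h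
    unfold SameCross at this h
    tauto
  have h2 := left_arc_over_iff hζ.inv hη.inv hd.inv_left.inv_right hc' (ζ x) (η y) (by
    rw [Equiv.Perm.inv_def, Equiv.symm_apply_apply]
    exact hy.symm)
  rw [Equiv.Perm.inv_def, Equiv.Perm.inv_def, Equiv.symm_apply_apply,
    Equiv.symm_apply_apply] at h2
  unfold Under
  tauto

/-- `P` and `Q` colour the points moved by `θ`, and arcs of different colours do not cross. -/
structure NonCrossing (P Q : ℕ+ → Prop) (θ : Equiv.Perm ℕ+) : Prop where
  disjoint : ∀ x, P x → ¬ Q x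
  cover : ∀ x, θ x ≠ x → P x ∨ Q x
  moved_left : ∀ x, P x → θ x ≠ x
  moved_right : ∀ x, Q x → θ x ≠ x
  apply_left : ∀ x, P x → P (θ x)
  apply_right : ∀ x, Q x → Q (θ x)
  under_left : ∀ x y, P x → Q y → (Under x (θ x) y ↔ Under x (θ x) (θ y))
  under_right : ∀ x y, Q x → P y → (Under x (θ x) y ↔ Under x (θ x) (θ y))

theorem NonCrossing.symm {P Q : ℕ+ → Prop} {θ : Equiv.Perm ℕ+} (h : NonCrossing P Q θ) :
    NonCrossing Q P θ where
  disjoint x hq hp := h.disjoint x hp hq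
  cover x hx := (h.cover x hx).symm
  moved_left := h.moved_right
  moved_right := h.moved_left
  apply_left := h.apply_right
  apply_right := h.apply_left
  under_left := h.under_right
  under_right := h.under_left

/-- Every value of `ξ` lies weakly between the argument and the value of `θ`. -/
structure ValuesBetween (ξ θ : Equiv.Perm ℕ+) : Prop where
  up : ∀ x, x ≤ θ x → x ≤ ξ x ∧ ξ x ≤ θ x
  down : ∀ x, θ x ≤ x → θ x ≤ ξ x ∧ ξ x ≤ x

theorem OrderCriterion.valuesBetween {η ζ : Equiv.Perm ℕ+} (h : OrderCriterion η ζ) :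
    ValuesBetween η ζ := ⟨h.up, h.down⟩

theorem ValuesBetween.apply_eq {ξ θ : Equiv.Perm ℕ+} (h : ValuesBetween ξ θ) {x : ℕ+}
    (hx : θ x = x) : ξ x = x :=
  le_antisymm (h.down x hx.le).2 (h.up x hx.ge).1

theorem ValuesBetween.under {ξ θ : Equiv.Perm ℕ+} (h : ValuesBetween ξ θ) {x : ℕ+}
    (h1 : ξ x ≠ x) (h2 : ξ x ≠ θ x) : Under x (θ x) (ξ x) := by
  have h3 := h.up x
  have h4 := h.down x
  unfold Under
  generalize ξ x = a at *
  generalize θ x = b at *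
  clear h
  rcases le_total x b with h | h <;> grind

/-- If `ξ` stabilizes a condition that only holds under an arc, then its converse is stable too. -/
theorem of_apply_of_under {ξ : Equiv.Perm ℕ+} {Q : ℕ+ → Prop} {x x' y : ℕ+}
    (h : ∀ z, Q z → Under x x' z → Q (ξ z) ∧ Under x x' (ξ z))
    (hy : Q (ξ y)) (hu : Under x x' (ξ y)) : Q y ∧ Under x x' y := by
  classical
  let S : Finset ℕ+ := (Finset.Icc 1 (max x x')).filter fun z => Q z ∧ Under x x' z
  have hS : ∀ z, z ∈ S ↔ Q z ∧ Under x x' z := by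
    intro z
    simp only [S, Finset.mem_filter, Finset.mem_Icc, and_iff_right_iff_imp]
    rintro ⟨-, h | h⟩
    · exact ⟨one_le, h.2.le.trans (le_max_right _ _)⟩
    · exact ⟨one_le, h.2.le.trans (le_max_left _ _)⟩
  refine (hS y).1 (mem_of_apply_mem (f := ξ) (fun z hz => ?_) ((hS _).2 ⟨hy, hu⟩))
  rw [hS] at hz ⊢
  exact h z hz.1 hz.2

theorem under_of_endpoints {x x' y y' z : ℕ+} (hy : Under x x' y) (hy' : Under x x' y')
    (hz : Under y y' z) : Under x x' z := by
  unfold Under at *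
  grind

theorem natAbs_lt_of_under {x x' y y' : ℕ+} (hy : Under x x' y) (hy' : Under x x' y') :
    ((y : ℤ) - y').natAbs < ((x : ℤ) - x').natAbs := by
  unfold Under at *
  simp only [← PNat.coe_lt_coe] at hy hy'
  omega

theorem NonCrossing.apply_under {θ ξ : Equiv.Perm ℕ+} (hξ : ValuesBetween ξ θ)
    {P Q : ℕ+ → Prop} (h : NonCrossing P Q θ) {x y : ℕ+} (hx : P x) (hy : Q y)
    (hu : Under x (θ x) y) : Q (ξ y) ∧ Under x (θ x) (ξ y) := by
  induction hn : ((x : ℤ) - θ x).natAbs using Nat.strong_induction_on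
    generalizing P Q x y with
  | _ n ih =>
    subst hn
    have hu' := (h.under_left x y hx hy).1 hu
    have hQ : Q (ξ y) := by
      by_cases hfix : θ (ξ y) = ξ y
      · rwa [ξ.injective (hξ.apply_eq hfix)]
      · refine (h.cover _ hfix).resolve_left fun hP => ?_
        have hne : ξ y ≠ y := fun hh => h.disjoint y (hh ▸ hP) hy
        have hne' : ξ y ≠ θ y := fun hh => h.disjoint _ hP (hh ▸ h.apply_right y hy)
        exact h.disjoint y (of_apply_of_under (fun z hz hzu =>
          ih _ (natAbs_lt_of_under hu hu') h.symm hy hz hzu rfl) hP (hξ.under hne hne')).1 hy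
    refine ⟨hQ, ?_⟩
    by_cases hne : ξ y = y
    · rwa [hne]
    by_cases hne' : ξ y = θ y
    · rwa [hne']
    · exact under_of_endpoints hu hu' (hξ.under hne hne')

theorem NonCrossing.apply_mem {θ ξ : Equiv.Perm ℕ+} (hξ : ValuesBetween ξ θ)
    {P Q : ℕ+ → Prop} (h : NonCrossing P Q θ) {x : ℕ+} (hx : P x) : P (ξ x) := by
  by_cases hfix : θ (ξ x) = ξ x
  · rwa [ξ.injective (hξ.apply_eq hfix)]
  · refine (h.cover _ hfix).resolve_right fun hQ => ?_
    have hne : ξ x ≠ x := fun hh => h.disjoint x hx (hh ▸ hQ)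
    have hne' : ξ x ≠ θ x := fun hh => h.disjoint _ (h.apply_left x hx) (hh ▸ hQ)
    exact h.disjoint x hx (of_apply_of_under (fun z hz hzu => h.apply_under hξ hx hz hzu)
      hQ (hξ.under hne hne')).1

theorem NonCrossing.under_apply_iff {θ ξ : Equiv.Perm ℕ+} (hξ : ValuesBetween ξ θ)
    {P Q : ℕ+ → Prop} (h : NonCrossing P Q θ) {x y : ℕ+} (hx : P x) (hy : Q y) :
    Under x (θ x) (ξ y) ↔ Under x (θ x) y :=
  ⟨fun hu => (of_apply_of_under (fun _ hz hzu => h.apply_under hξ hx hz hzu)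
    (h.symm.apply_mem hξ hy) hu).2, fun hu => (h.apply_under hξ hx hy hu).2⟩

theorem NonCrossing.apply_lt_apply {θ ξ ξ' : Equiv.Perm ℕ+} (hξ : ValuesBetween ξ ξ')
    (hξ' : ValuesBetween ξ' θ) {P Q : ℕ+ → Prop} (h : NonCrossing P Q θ) {x y : ℕ+}
    (hx : P x) (hy : Q y) (hxy : x < y) (hlt : ξ' x < ξ' y)
    (hdir : (x < ξ' x ∧ y < ξ' y) ∨ (ξ' x < x ∧ ξ' y < y)) : ξ x < ξ y := by
  have hx' := h.apply_mem hξ' hx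
  have hy' := h.symm.apply_mem hξ' hy
  have h1 := h.under_apply_iff hξ' hx hy
  have h2 := h.symm.under_apply_iff hξ' hy hx
  have h3 : ξ' x ≠ y := fun hh => h.disjoint y (hh ▸ hx') hy
  have h4 : ξ' y ≠ x := fun hh => h.disjoint x hx (hh ▸ hy')
  have h5 : ξ' x ≠ θ y := fun hh => h.disjoint _ hx' (hh ▸ h.apply_right y hy)
  have h6 : ξ' y ≠ θ x := fun hh => h.disjoint _ (h.apply_left x hx) (hh ▸ hy')
  have c1 := hξ.up x
  have c2 := hξ.up y
  have c3 := hξ.down x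
  have c4 := hξ.down y
  have c5 := hξ'.up y
  have c6 := hξ'.down y
  have c7 := hξ'.up x
  have c8 := hξ'.down x
  unfold Under at h1 h2
  clear h hx hy hx' hy' hξ hξ'
  generalize θ x = tx at *
  generalize θ y = ty at *
  generalize ξ' x = sx at *
  generalize ξ' y = sy at *
  generalize ξ x = rx at *
  generalize ξ y = ry at *
  rcases hdir with hdir | hdir <;> grind

theorem NonCrossing.orderCriterion_glue {θ ξ ξ' a a' b b' : Equiv.Perm ℕ+} {P Q : ℕ+ → Prop}
    (h : NonCrossing P Q θ) (hξ' : ValuesBetween ξ' θ)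
    (hP : ∀ x, P x → ξ x = a x ∧ ξ' x = a' x) (hQ : ∀ x, Q x → ξ x = b x ∧ ξ' x = b' x)
    (h0 : ∀ x, θ x = x → ξ x = x) (ha : OrderCriterion a a') (hb : OrderCriterion b b') :
    OrderCriterion ξ ξ' := by
  have hcover : ∀ x, (P x ∨ Q x) ∨ (ξ x = x ∧ ξ' x = x) := fun x => by
    by_cases hx : θ x = x
    · exact Or.inr ⟨h0 x hx, hξ'.apply_eq hx⟩
    · exact Or.inl (h.cover x hx)
  have hbetween : ValuesBetween ξ ξ' := by
    refine ⟨fun x hx => ?_, fun x hx => ?_⟩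
    · rcases hcover x with (hx' | hx') | hx'
      · rw [(hP x hx').2] at hx ⊢
        rw [(hP x hx').1]
        exact ha.up x hx
      · rw [(hQ x hx').2] at hx ⊢
        rw [(hQ x hx').1]
        exact hb.up x hx
      · simp [hx']
    · rcases hcover x with (hx' | hx') | hx'
      · rw [(hP x hx').2] at hx ⊢
        rw [(hP x hx').1]
        exact ha.down x hx
      · rw [(hQ x hx').2] at hx ⊢
        rw [(hQ x hx').1]
        exact hb.down x hx
      · simp [hx']
  refine ⟨hbetween.up, hbetween.down, fun x y hxy hlt hdir => ?_⟩
  have hx : P x ∨ Q x := (hcover x).resolve_right fun hx =>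
    hdir.elim (fun hd => hd.1.ne' hx.2) fun hd => hd.1.ne hx.2
  have hy : P y ∨ Q y := (hcover y).resolve_right fun hy =>
    hdir.elim (fun hd => hd.2.ne' hy.2) fun hd => hd.2.ne hy.2
  rcases hx with hx | hx <;> rcases hy with hy | hy
  · rw [(hP x hx).2, (hP y hy).2] at hlt hdir
    rw [(hP x hx).1, (hP y hy).1]
    exact ha.mono x y hxy hlt hdir
  · exact h.apply_lt_apply hbetween hξ' hx hy hxy hlt hdir
  · exact h.symm.apply_lt_apply hbetween hξ' hx hy hxy hlt hdir
  · rw [(hQ x hx).2, (hQ y hy).2] at hlt hdir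
    rw [(hQ x hx).1, (hQ y hy).1]
    exact hb.mono x y hxy hlt hdir

theorem OrderCriterion.restrict {ξ ξ' a a' : Equiv.Perm ℕ+} {P : ℕ+ → Prop}
    (h : OrderCriterion ξ ξ') (hP : ∀ x, P x → ξ x = a x ∧ ξ' x = a' x)
    (h0 : ∀ x, ¬ P x → a x = x ∧ a' x = x) : OrderCriterion a a' := by
  refine ⟨fun x hx => ?_, fun x hx => ?_, fun x y hxy hlt hdir => ?_⟩
  · by_cases hx' : P x
    · rw [← (hP x hx').2] at hx ⊢
      rw [← (hP x hx').1]
      exact h.up x hx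
    · simp [h0 x hx']
  · by_cases hx' : P x
    · rw [← (hP x hx').2] at hx ⊢
      rw [← (hP x hx').1]
      exact h.down x hx
    · simp [h0 x hx']
  · have hx : P x := by
      by_contra hx
      exact hdir.elim (fun hd => hd.1.ne' (h0 x hx).2) fun hd => hd.1.ne (h0 x hx).2
    have hy : P y := by
      by_contra hy
      exact hdir.elim (fun hd => hd.2.ne' (h0 y hy).2) fun hd => hd.2.ne (h0 y hy).2
    rw [← (hP x hx).2, ← (hP y hy).2] at hlt hdir
    rw [← (hP x hx).1, ← (hP y hy).1]
    exact h.mono x y hxy hlt hdir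

theorem OrderCriterion.one (ζ : Equiv.Perm ℕ+) : OrderCriterion 1 ζ :=
  ⟨fun _ hx => ⟨le_rfl, hx⟩, fun _ hx => ⟨hx, le_rfl⟩, fun _ _ hxy _ _ => hxy⟩

theorem mul_apply_of_valuesBetween {ζ η a b : Equiv.Perm ℕ+} (hd : ζ.Disjoint η)
    (ha : ValuesBetween a ζ) (hb : ValuesBetween b η) :
    (∀ x, ζ x ≠ x → (a * b) x = a x) ∧ (∀ x, η x ≠ x → (a * b) x = b x) ∧
      ∀ x, ζ x = x → η x = x → (a * b) x = x := by
  refine ⟨fun x hx => ?_, fun x hx => ?_, fun x hx hx' => ?_⟩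
  · rw [Equiv.Perm.mul_apply, hb.apply_eq ((hd x).resolve_left hx)]
  · rw [Equiv.Perm.mul_apply]
    by_cases hbx : b x = x
    · rw [hbx, ha.apply_eq ((hd x).resolve_right hx)]
    · exact ha.apply_eq ((hd (b x)).resolve_right fun hh => hbx (b.injective (hb.apply_eq hh)))
  · rw [Equiv.Perm.mul_apply, hb.apply_eq hx', ha.apply_eq hx]

theorem ValuesBetween.refl (ζ : Equiv.Perm ℕ+) : ValuesBetween ζ ζ :=
  ⟨fun _ hx => ⟨hx, le_rfl⟩, fun _ hx => ⟨le_rfl, hx⟩⟩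

theorem ValuesBetween.mul {ζ η a b : Equiv.Perm ℕ+} (hd : ζ.Disjoint η)
    (ha : ValuesBetween a ζ) (hb : ValuesBetween b η) : ValuesBetween (a * b) (ζ * η) := by
  obtain ⟨h1, h2, h3⟩ := mul_apply_of_valuesBetween hd ha hb
  obtain ⟨k1, k2, k3⟩ := mul_apply_of_valuesBetween hd (.refl ζ) (.refl η)
  refine ⟨fun x hx => ?_, fun x hx => ?_⟩
  · by_cases hx1 : ζ x = x
    · by_cases hx2 : η x = x
      · rw [h3 x hx1 hx2, k3 x hx1 hx2]
        exact ⟨le_rfl, le_rfl⟩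
      · rw [k2 x hx2] at hx ⊢
        rw [h2 x hx2]
        exact hb.up x hx
    · rw [k1 x hx1] at hx ⊢
      rw [h1 x hx1]
      exact ha.up x hx
  · by_cases hx1 : ζ x = x
    · by_cases hx2 : η x = x
      · rw [h3 x hx1 hx2, k3 x hx1 hx2]
        exact ⟨le_rfl, le_rfl⟩
      · rw [k2 x hx2] at hx ⊢
        rw [h2 x hx2]
        exact hb.down x hx
    · rw [k1 x hx1] at hx ⊢
      rw [h1 x hx1]
      exact ha.down x hx

/-- Comparison of products inside a product of intervals. -/
theorem orderCriterion_mul_iff {ζ η a a' b b' : Equiv.Perm ℕ+} (hd : ζ.Disjoint η)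
    (h : NonCrossing (fun x => ζ x ≠ x) (fun x => η x ≠ x) (ζ * η))
    (ha : ValuesBetween a ζ) (hb : ValuesBetween b η)
    (ha' : ValuesBetween a' ζ) (hb' : ValuesBetween b' η) :
    (OrderCriterion a a' ∧ OrderCriterion b b') ↔ OrderCriterion (a * b) (a' * b') := by
  obtain ⟨h1, h2, h3⟩ := mul_apply_of_valuesBetween hd ha hb
  obtain ⟨k1, k2, k3⟩ := mul_apply_of_valuesBetween hd ha' hb'
  refine ⟨fun hab => ?_, fun hab => ⟨?_, ?_⟩⟩
  · exact h.orderCriterion_glue (ha'.mul hd hb') (fun x hx => ⟨h1 x hx, k1 x hx⟩)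
      (fun x hx => ⟨h2 x hx, k2 x hx⟩) (fun x hx => (ha.mul hd hb).apply_eq hx) hab.1 hab.2
  · exact hab.restrict (fun x hx => ⟨h1 x hx, k1 x hx⟩) fun x hx =>
      ⟨ha.apply_eq (not_not.mp hx), ha'.apply_eq (not_not.mp hx)⟩
  · exact hab.restrict (fun x hx => ⟨h2 x hx, k2 x hx⟩) fun x hx =>
      ⟨hb.apply_eq (not_not.mp hx), hb'.apply_eq (not_not.mp hx)⟩

theorem nonCrossing_of_not_sameCross {ζ η : Equiv.Perm ℕ+} (hζ : FinSupp ζ) (hη : FinSupp η)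
    (hd : ζ.Disjoint η) (hc : ∀ x y, ¬ SameCross x (ζ x) y (η y)) :
    NonCrossing (fun x => ζ x ≠ x) (fun x => η x ≠ x) (ζ * η) := by
  obtain ⟨k1, k2, k3⟩ := mul_apply_of_valuesBetween hd (.refl ζ) (.refl η)
  have hc' : ∀ x y, ¬ SameCross x (η x) y (ζ y) := fun x y hxy => hc y x (by
    unfold SameCross at hxy ⊢
    tauto)
  refine ⟨fun x hx hx' => (hd x).elim hx hx', fun x hx => ?_, fun x hx => ?_, fun x hx => ?_,
    fun x hx => ?_, fun x hx => ?_, fun x y hx hy => ?_, fun x y hx hy => ?_⟩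
  · by_contra hh
    push Not at hh
    exact hx (k3 x hh.1 hh.2)
  · rwa [k1 x hx]
  · rwa [k2 x hx]
  · rw [k1 x hx]
    exact fun hh => hx (ζ.injective hh)
  · rw [k2 x hx]
    exact fun hh => hx (η.injective hh)
  · rw [k1 x hx, k2 y hy]
    exact under_iff_under_apply hζ hη hd hc x y hy
  · rw [k2 x hx, k1 y hy]
    exact under_iff_under_apply hη hζ hd.symm hc' x y hy

/-- A permutation below `ζ * η` factors along the two supports. -/
theorem NonCrossing.exists_mul_eq {ζ η ξ : Equiv.Perm ℕ+} (hd : ζ.Disjoint η)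
    (h : NonCrossing (fun x => ζ x ≠ x) (fun x => η x ≠ x) (ζ * η))
    (hξ : ValuesBetween ξ (ζ * η)) :
    ∃ a b, ValuesBetween a ζ ∧ ValuesBetween b η ∧ a * b = ξ := by
  classical
  obtain ⟨k1, k2, k3⟩ := mul_apply_of_valuesBetween hd (.refl ζ) (.refl η)
  have hfix : ∀ x, ζ x = x → η x = x → ξ x = x := fun x h1 h2 => hξ.apply_eq (k3 x h1 h2)
  have hP : ∀ x, ζ (ξ x) ≠ ξ x ↔ ζ x ≠ x := by
    refine fun x => ⟨fun hx hx' => ?_, fun hx => h.apply_mem hξ hx⟩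
    by_cases hη : η x = x
    · rw [hfix x hx' hη] at hx
      exact hx hx'
    · exact h.disjoint _ hx (h.symm.apply_mem hξ hη)
  have hQ : ∀ x, η (ξ x) ≠ ξ x ↔ η x ≠ x := by
    refine fun x => ⟨fun hx hx' => ?_, fun hx => h.symm.apply_mem hξ hx⟩
    by_cases hζ : ζ x = x
    · rw [hfix x hζ hx'] at hx
      exact hx hx'
    · exact h.disjoint _ (h.apply_mem hξ hζ) hx
  let a : Equiv.Perm ℕ+ := Equiv.Perm.ofSubtype (ξ.subtypePerm (p := fun x => ζ x ≠ x) hP)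
  let b : Equiv.Perm ℕ+ := Equiv.Perm.ofSubtype (ξ.subtypePerm (p := fun x => η x ≠ x) hQ)
  have ha1 : ∀ x, ζ x ≠ x → a x = ξ x := fun x hx =>
    Equiv.Perm.ofSubtype_apply_of_mem (ξ.subtypePerm (p := fun x => ζ x ≠ x) hP) hx
  have ha2 : ∀ x, ζ x = x → a x = x := fun x hx =>
    Equiv.Perm.ofSubtype_apply_of_not_mem (ξ.subtypePerm (p := fun x => ζ x ≠ x) hP)
      (not_not.mpr hx)
  have hb1 : ∀ x, η x ≠ x → b x = ξ x := fun x hx =>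
    Equiv.Perm.ofSubtype_apply_of_mem (ξ.subtypePerm (p := fun x => η x ≠ x) hQ) hx
  have hb2 : ∀ x, η x = x → b x = x := fun x hx =>
    Equiv.Perm.ofSubtype_apply_of_not_mem (ξ.subtypePerm (p := fun x => η x ≠ x) hQ)
      (not_not.mpr hx)
  have ha : ValuesBetween a ζ := by
    refine ⟨fun x hx => ?_, fun x hx => ?_⟩ <;> by_cases hx' : ζ x = x
    · rw [ha2 x hx', hx']
      exact ⟨le_rfl, le_rfl⟩
    · rw [ha1 x hx', ← k1 x hx']
      rw [← k1 x hx'] at hx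
      exact hξ.up x hx
    · rw [ha2 x hx', hx']
      exact ⟨le_rfl, le_rfl⟩
    · rw [ha1 x hx', ← k1 x hx']
      rw [← k1 x hx'] at hx
      exact hξ.down x hx
  have hb : ValuesBetween b η := by
    refine ⟨fun x hx => ?_, fun x hx => ?_⟩ <;> by_cases hx' : η x = x
    · rw [hb2 x hx', hx']
      exact ⟨le_rfl, le_rfl⟩
    · rw [hb1 x hx', ← k2 x hx']
      rw [← k2 x hx'] at hx
      exact hξ.up x hx
    · rw [hb2 x hx', hx']
      exact ⟨le_rfl, le_rfl⟩
    · rw [hb1 x hx', ← k2 x hx']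
      rw [← k2 x hx'] at hx
      exact hξ.down x hx
  obtain ⟨h1, h2, h3⟩ := mul_apply_of_valuesBetween hd ha hb
  refine ⟨a, b, ha, hb, Equiv.ext fun x => ?_⟩
  by_cases hx : ζ x = x
  · by_cases hx' : η x = x
    · rw [h3 x hx hx', hfix x hx hx']
    · rw [h2 x hx', hb1 x hx']
  · rw [h1 x hx, ha1 x hx]

theorem eq_of_mul_eq_mul_of_valuesBetween {ζ η a a' b b' : Equiv.Perm ℕ+} (hd : ζ.Disjoint η)
    (ha : ValuesBetween a ζ) (hb : ValuesBetween b η)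
    (ha' : ValuesBetween a' ζ) (hb' : ValuesBetween b' η) (hab : a * b = a' * b') :
    a = a' ∧ b = b' := by
  have haa : a = a' := by
    refine Equiv.ext fun x => ?_
    by_cases hx : ζ x = x
    · rw [ha.apply_eq hx, ha'.apply_eq hx]
    · rw [← (mul_apply_of_valuesBetween hd ha hb).1 x hx, hab,
        (mul_apply_of_valuesBetween hd ha' hb').1 x hx]
  subst haa
  exact ⟨rfl, mul_left_cancel hab⟩

/-- Arcs of a disjoint product do not cross. -/
theorem nonCrossing_of_rank_add {ζ η u u₁ u₂ : Equiv.Perm ℕ+} {k k₁ k₂ : ℕ+}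
    (hζ : FinSupp ζ) (hη : FinSupp η) (hd : ζ.Disjoint η)
    (hu : FinSupp u) (hu₁ : FinSupp u₁) (hu₂ : FinSupp u₂)
    (h : kBruhat k u (ζ * η * u)) (h₁ : kBruhat k₁ u₁ (ζ * u₁)) (h₂ : kBruhat k₂ u₂ (η * u₂))
    (hrank : (len (ζ * η * u) : ℤ) - (len u : ℤ) =
      ((len (ζ * u₁) : ℤ) - (len u₁ : ℤ)) + ((len (η * u₂) : ℤ) - (len u₂ : ℤ))) :
    NonCrossing (fun x => ζ x ≠ x) (fun x => η x ≠ x) (ζ * η) := by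
  obtain ⟨N, hNζ⟩ := hζ.exists_fixAbove
  obtain ⟨N', hNη⟩ := hη.exists_fixAbove
  obtain ⟨M, hM⟩ := hu.exists_fixAbove
  obtain ⟨M₁, hM₁⟩ := hu₁.exists_fixAbove
  obtain ⟨M₂, hM₂⟩ := hu₂.exists_fixAbove
  obtain ⟨K, hK, hK', hKM, hKM₁, hKM₂⟩ : ∃ K, N ≤ K ∧ N' ≤ K ∧ M ≤ K ∧ M₁ ≤ K ∧ M₂ ≤ K :=
    ⟨max N (max N' (max M (max M₁ M₂))), by simp, by simp, by simp, by simp, by simp⟩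
  have e := (h.kDominated hu).2.two_mul_len_sub (hM.mono hKM) ((hNζ.mono hK).mul (hNη.mono hK'))
  have e₁ := (h₁.kDominated hu₁).2.two_mul_len_sub (hM₁.mono hKM₁) (hNζ.mono hK)
  have e₂ := (h₂.kDominated hu₂).2.two_mul_len_sub (hM₂.mono hKM₂) (hNη.mono hK')
  exact nonCrossing_of_not_sameCross hζ hη hd (not_sameCross_of_signedInv (hNζ.mono hK)
    (hNη.mono hK') hd (by linarith))

/-- Disjointness theorem, part (1).  Suppose the product `ζ·η` is disjoint:
`ζ` and `η` have disjoint supports and `|ζη| = |ζ| + |η|` (ranks computed via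
`|ξ| = ℓ(ξu) - ℓ(u)` for witnesses `u ≤_k ξu`).  Then `(α,β) ↦ αβ` induces an
order isomorphism `[e,ζ]_⪯ × [e,η]_⪯ ≅ [e,ζη]_⪯`: it maps the product of
intervals into `[e,ζη]_⪯`, is onto and injective, and a pair is below another
in the product order iff the corresponding products are related by `⪯`. -/
theorem stmt_16 (ζ η : Equiv.Perm ℕ+) (hζ : FinSupp ζ) (hη : FinSupp η)
    (hdisj : Disjoint {a : ℕ+ | ζ a ≠ a} {a : ℕ+ | η a ≠ a})
    (hrank : ∃ (u u₁ u₂ : Equiv.Perm ℕ+) (k k₁ k₂ : ℕ+),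
      FinSupp u ∧ FinSupp u₁ ∧ FinSupp u₂ ∧
      kBruhat k u (ζ * η * u) ∧ kBruhat k₁ u₁ (ζ * u₁) ∧ kBruhat k₂ u₂ (η * u₂) ∧
      (len (ζ * η * u) : ℤ) - (len u : ℤ) =
        ((len (ζ * u₁) : ℤ) - (len u₁ : ℤ)) + ((len (η * u₂) : ℤ) - (len u₂ : ℤ))) :
    (∀ a b : Equiv.Perm ℕ+, NewOrder 1 a → NewOrder a ζ →
        NewOrder 1 b → NewOrder b η →
        NewOrder 1 (a * b) ∧ NewOrder (a * b) (ζ * η)) ∧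
    (∀ ξ : Equiv.Perm ℕ+, NewOrder 1 ξ → NewOrder ξ (ζ * η) →
        ∃ a b : Equiv.Perm ℕ+, (NewOrder 1 a ∧ NewOrder a ζ) ∧
          (NewOrder 1 b ∧ NewOrder b η) ∧ a * b = ξ) ∧
    (∀ a b a' b' : Equiv.Perm ℕ+,
        NewOrder 1 a → NewOrder a ζ → NewOrder 1 b → NewOrder b η →
        NewOrder 1 a' → NewOrder a' ζ → NewOrder 1 b' → NewOrder b' η →
        (a * b = a' * b' → a = a' ∧ b = b') ∧
        ((NewOrder a a' ∧ NewOrder b b') ↔ NewOrder (a * b) (a' * b'))) := by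
  have hd : ζ.Disjoint η := fun x => by
    by_contra hx
    push Not at hx
    exact Set.disjoint_left.1 hdisj hx.1 hx.2
  obtain ⟨u, u₁, u₂, k, k₁, k₂, hu, hu₁, hu₂, h, h₁, h₂, hlen⟩ := hrank
  have hnc := nonCrossing_of_rank_add hζ hη hd hu hu₁ hu₂ h h₁ h₂ hlen
  have hζη : FinSupp (ζ * η) := hζ.mul hη
  have hmul : ∀ a b : Equiv.Perm ℕ+, ValuesBetween a ζ → ValuesBetween b η →
      ((OrderCriterion a ζ ∧ OrderCriterion b η) ↔ OrderCriterion (a * b) (ζ * η)) :=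
    fun a b ha hb => orderCriterion_mul_iff hd hnc ha hb (.refl ζ) (.refl η)
  simp only [newOrder_iff, OrderCriterion.one, and_true, hζ, hη, hζη, true_and]
  refine ⟨fun a b ha haζ hb hbη =>
    ⟨ha.mul hb, (hmul a b haζ.valuesBetween hbη.valuesBetween).1 ⟨haζ, hbη⟩⟩, ?_, ?_⟩
  · intro ξ _ hξ
    obtain ⟨a, b, ha, hb, rfl⟩ := hnc.exists_mul_eq hd hξ.valuesBetween
    obtain ⟨haζ, hbη⟩ := (hmul a b ha hb).2 hξ
    exact ⟨a, b, ⟨haζ.finSupp hζ, haζ⟩, ⟨hbη.finSupp hη, hbη⟩, rfl⟩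
  · intro a b a' b' _ haζ _ hbη ha' haζ' hb' hbη'
    refine ⟨eq_of_mul_eq_mul_of_valuesBetween hd haζ.valuesBetween hbη.valuesBetween
      haζ'.valuesBetween hbη'.valuesBetween, ?_⟩
    simp only [ha', hb', ha'.mul hb', true_and]
    exact orderCriterion_mul_iff hd hnc haζ.valuesBetween hbη.valuesBetween
      haζ'.valuesBetween hbη'.valuesBetween
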